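/- arXiv:1201.4529 — 5 statements merged into one kernel-verified Lean document; each statement's English description precedes it below -/
import Mathlib

section
/- Let K be a Markov kernel on a measurable space (E, ℰ) with invariant probability measure π, and suppose there exist ε ∈ (0,1) and a probability measure κ on E such that K(x,·) ≥ ε κ(·) for all x ∈ E. Then for every p ≥ 1 there exists a finite constant B(p,ε), depending only on p and ε, such that for every bounded measurable f : E → ℝ, every initial point x ∈ E, and every N ≥ 1, E_x[ | (1/N) Σ_{i=1}^N f(X_i) − π(f) |^p ]^{1/p} ≤ B(p,ε) ‖f‖ / √N, where (X_i)_{i≥1} is the Markov chain with transition kernel K started at X_1 = x, π(f) = ∫ f dπ, and ‖f‖ = sup_x |f(x)|. -/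
open MeasureTheory ProbabilityTheory
open scoped ENNReal NNReal

/-- The σ-algebra on `Ω` generated by `X 0, …, X i` (natural filtration of the process). -/
def natSigma {Ω E : Type*} [MeasurableSpace E] (X : ℕ → Ω → E) (i : ℕ) :
    MeasurableSpace Ω :=
  ⨆ (j : ℕ) (_ : j ≤ i), MeasurableSpace.comap (X j) inferInstance

section BoundedFunctions

variable {E : Type*} [MeasurableSpace E]

lemma integrable_of_measurable_of_abs_le {μ : Measure E} [IsFiniteMeasure μ] {f : E → ℝ} {C : ℝ}
    (hf : Measurable f) (hC : ∀ x, |f x| ≤ C) : Integrable f μ :=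
  Integrable.of_bound hf.aestronglyMeasurable C (ae_of_all _ hC)

/-- The action `f ↦ (x ↦ ∫ f dK(x, ·))` of a kernel on functions. -/
noncomputable def kernelAction (K : Kernel E E) (f : E → ℝ) : E → ℝ :=
  fun x => ∫ y, f y ∂(K x)

lemma measurable_kernelAction (K : Kernel E E) {f : E → ℝ} (hf : Measurable f) :
    Measurable (kernelAction K f) :=
  (hf.stronglyMeasurable.integral_kernel (κ := K)).measurable

lemma abs_kernelAction_le (K : Kernel E E) [IsMarkovKernel K] {f : E → ℝ} {C : ℝ}
    (hC : ∀ x, |f x| ≤ C) (x : E) : |kernelAction K f x| ≤ C := by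
  have h : ∀ y, ‖f y‖ ≤ C := hC
  simpa [kernelAction] using norm_integral_le_of_norm_le_const (ae_of_all (K x) h)

lemma measurable_kernelAction_iterate (K : Kernel E E) {f : E → ℝ} (hf : Measurable f) (n : ℕ) :
    Measurable ((kernelAction K)^[n] f) := by
  induction n with
  | zero => exact hf
  | succ n ih =>
    rw [Function.iterate_succ_apply']
    exact measurable_kernelAction K ih

lemma abs_kernelAction_iterate_le (K : Kernel E E) [IsMarkovKernel K] {f : E → ℝ} {C : ℝ}
    (hC : ∀ x, |f x| ≤ C) (n : ℕ) : ∀ x, |(kernelAction K)^[n] f x| ≤ C := by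
  induction n with
  | zero => exact hC
  | succ n ih =>
    rw [Function.iterate_succ_apply']
    exact abs_kernelAction_le K ih

lemma integral_kernelAction_of_bind_eq (K : Kernel E E) [IsMarkovKernel K] {π : Measure E}
    [IsProbabilityMeasure π] (hπ : π.bind (fun x => K x) = π) {f : E → ℝ} {C : ℝ}
    (hf : Measurable f) (hC : ∀ x, |f x| ≤ C) :
    ∫ x, kernelAction K f x ∂π = ∫ x, f x ∂π := by
  have hcomp : (K ∘ₖ Kernel.const Unit π) () = π := by
    rw [Kernel.comp_apply, Kernel.const_apply]
    exact hπ
  have h := Kernel.integral_comp (η := K) (κ := Kernel.const Unit π) (a := ()) (f := f)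
    (integrable_of_measurable_of_abs_le hf hC)
  rw [hcomp, Kernel.const_apply] at h
  exact h.symm

lemma integral_kernelAction_iterate (K : Kernel E E) [IsMarkovKernel K] {π : Measure E}
    [IsProbabilityMeasure π] (hπ : π.bind (fun x => K x) = π) {f : E → ℝ} {C : ℝ}
    (hf : Measurable f) (hC : ∀ x, |f x| ≤ C) (n : ℕ) :
    ∫ x, (kernelAction K)^[n] f x ∂π = ∫ x, f x ∂π := by
  induction n with
  | zero => rfl
  | succ n ih =>
    rw [Function.iterate_succ_apply', integral_kernelAction_of_bind_eq K hπ
      (measurable_kernelAction_iterate K hf n) (abs_kernelAction_iterate_le K hC n), ih]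

end BoundedFunctions

section Doeblin

variable {E : Type*} [MeasurableSpace E]

lemma mul_integral_le_integral_of_smul_le {ε : ℝ} (hε : 0 ≤ ε) {κ ν : Measure E} [IsFiniteMeasure ν]
    (h : ENNReal.ofReal ε • κ ≤ ν) {f : E → ℝ} {C : ℝ} (hf : Measurable f)
    (hC : ∀ x, |f x| ≤ C) (h0 : ∀ x, 0 ≤ f x) : ε * ∫ x, f x ∂κ ≤ ∫ x, f x ∂ν := by
  have := integral_mono_measure h (ae_of_all _ h0) (integrable_of_measurable_of_abs_le hf hC)
  rwa [integral_smul_measure, ENNReal.toReal_ofReal hε, smul_eq_mul] at this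

/-- A minorized probability measure integrates a function with values in `[a, b]` into an interval
of length `(1 - ε) * (b - a)` which depends only on the minorizing measure. -/
lemma integral_mem_Icc_of_smul_le {ε : ℝ} (hε : 0 ≤ ε) {κ ν : Measure E} [IsProbabilityMeasure κ]
    [IsProbabilityMeasure ν] (h : ENNReal.ofReal ε • κ ≤ ν) {f : E → ℝ} {a b : ℝ}
    (hf : Measurable f) (hab : ∀ x, f x ∈ Set.Icc a b) :
    ∫ x, f x ∂ν ∈ Set.Icc (ε * ∫ x, f x ∂κ + (1 - ε) * a) (ε * ∫ x, f x ∂κ + (1 - ε) * b) := by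
  have hC : ∀ x, |f x| ≤ max |a| |b| := fun x => abs_le_max_abs_abs (hab x).1 (hab x).2
  have hiκ : Integrable f κ := integrable_of_measurable_of_abs_le hf hC
  have hiν : Integrable f ν := integrable_of_measurable_of_abs_le hf hC
  have hl := mul_integral_le_integral_of_smul_le hε h (f := fun x => f x - a) (C := b - a)
    (hf.sub_const a)
    (fun x => abs_le.2 ⟨by linarith [(hab x).1, (hab x).2], by linarith [(hab x).2]⟩)
    (fun x => by linarith [(hab x).1])
  have hu := mul_integral_le_integral_of_smul_le hε h (f := fun x => b - f x) (C := b - a)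
    (hf.const_sub b)
    (fun x => abs_le.2 ⟨by linarith [(hab x).1, (hab x).2], by linarith [(hab x).1]⟩)
    (fun x => by linarith [(hab x).2])
  rw [integral_sub hiκ (integrable_const _), integral_sub hiν (integrable_const _)] at hl
  rw [integral_sub (integrable_const _) hiκ, integral_sub (integrable_const _) hiν] at hu
  simp only [integral_const, probReal_univ, one_smul] at hl hu
  constructor <;> linarith

variable {K : Kernel E E} [IsMarkovKernel K] {π κ : Measure E} [IsProbabilityMeasure π]
  [IsProbabilityMeasure κ] {ε C : ℝ} {f : E → ℝ}

lemma exists_kernelAction_iterate_mem_Icc (hε : 0 ≤ ε)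
    (hK : ∀ x, ENNReal.ofReal ε • κ ≤ K x) (hf : Measurable f) (hC : ∀ x, |f x| ≤ C) (n : ℕ) :
    ∃ a, ∀ x, (kernelAction K)^[n] f x ∈ Set.Icc a (a + 2 * C * (1 - ε) ^ n) := by
  induction n with
  | zero =>
    refine ⟨-C, fun x => ?_⟩
    have := abs_le.1 (hC x)
    simp only [Function.iterate_zero, id_eq, pow_zero, mul_one, Set.mem_Icc]
    constructor <;> linarith
  | succ n ih =>
    obtain ⟨a, ha⟩ := ih
    refine ⟨ε * ∫ y, (kernelAction K)^[n] f y ∂κ + (1 - ε) * a, fun x => ?_⟩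
    rw [Function.iterate_succ_apply']
    have h := integral_mem_Icc_of_smul_le hε (hK x) (measurable_kernelAction_iterate K hf n) ha
    exact ⟨h.1, h.2.trans_eq (by ring)⟩

lemma abs_kernelAction_iterate_sub_le (hε : 0 ≤ ε) (hπ : π.bind (fun x => K x) = π)
    (hK : ∀ x, ENNReal.ofReal ε • κ ≤ K x) (hf : Measurable f) (hC : ∀ x, |f x| ≤ C) (n : ℕ)
    (x : E) : |(kernelAction K)^[n] f x - ∫ y, f y ∂π| ≤ 2 * C * (1 - ε) ^ n := by
  obtain ⟨a, ha⟩ := exists_kernelAction_iterate_mem_Icc hε hK hf hC n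
  have hi : Integrable ((kernelAction K)^[n] f) π := integrable_of_measurable_of_abs_le
    (measurable_kernelAction_iterate K hf n) (abs_kernelAction_iterate_le K hC n)
  have hl := integral_mono (integrable_const a) hi (fun y => (ha y).1)
  have hu := integral_mono hi (integrable_const (a + 2 * C * (1 - ε) ^ n)) (fun y => (ha y).2)
  rw [integral_kernelAction_iterate K hπ hf hC] at hl hu
  simp only [integral_const, probReal_univ, one_smul] at hl hu
  have := ha x
  exact abs_le.2 ⟨by linarith [this.1], by linarith [this.2]⟩

lemma sum_one_sub_pow_le_inv (hε : ε ∈ Set.Ioo (0 : ℝ) 1) (N : ℕ) :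
    ∑ n ∈ Finset.range N, (1 - ε) ^ n ≤ ε⁻¹ := by
  have h0 : 0 < ε := hε.1
  have h := geom_sum_mul_neg (1 - ε) N
  rw [sub_sub_cancel] at h
  rw [← one_div, le_div_iff₀ h0, h]
  linarith [pow_nonneg (sub_nonneg.2 hε.2.le) N]

lemma mul_one_sub_pow_le_inv (hε : ε ∈ Set.Ioo (0 : ℝ) 1) (N : ℕ) :
    N * (1 - ε) ^ N ≤ ε⁻¹ := by
  refine le_trans ?_ (sum_one_sub_pow_le_inv hε N)
  rw [← nsmul_eq_mul, ← Finset.card_range N, ← Finset.sum_const, Finset.card_range]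
  refine Finset.sum_le_sum fun n hn => ?_
  exact pow_le_pow_of_le_one (by linarith [hε.2]) (by linarith [hε.1]) (Finset.mem_range.1 hn).le

/-- Approximate solution of the Poisson equation `g - K g = f - π f`. -/
lemma exists_approx_poisson (hε : ε ∈ Set.Ioo (0 : ℝ) 1) (hπ : π.bind (fun x => K x) = π)
    (hK : ∀ x, ENNReal.ofReal ε • κ ≤ K x) (hf : Measurable f) (hC0 : 0 ≤ C)
    (hC : ∀ x, |f x| ≤ C) (N : ℕ) :
    ∃ g : E → ℝ, Measurable g ∧ (∀ x, |g x| ≤ 2 * C / ε) ∧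
      ∀ x, |f x - ∫ y, f y ∂π - (g x - kernelAction K g x)| ≤ 2 * C * (1 - ε) ^ N := by
  have hmeas := measurable_kernelAction_iterate K hf
  have hbd := abs_kernelAction_iterate_sub_le hε.1.le hπ hK hf hC
  refine ⟨fun x => ∑ n ∈ Finset.range N, ((kernelAction K)^[n] f x - ∫ y, f y ∂π), ?_, ?_, ?_⟩
  · exact Finset.measurable_fun_sum _ fun n _ => (hmeas n).sub_const _
  · intro x
    calc _ ≤ ∑ n ∈ Finset.range N, 2 * C * (1 - ε) ^ n :=
          (Finset.abs_sum_le_sum_abs _ _).trans (Finset.sum_le_sum fun n _ => hbd n x)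
      _ ≤ 2 * C / ε := by
          rw [← Finset.mul_sum, div_eq_mul_inv]
          exact mul_le_mul_of_nonneg_left (sum_one_sub_pow_le_inv hε N) (by positivity)
  · intro x
    have hi (n : ℕ) : Integrable ((kernelAction K)^[n] f) (K x) :=
      integrable_of_measurable_of_abs_le (hmeas n) (abs_kernelAction_iterate_le K hC n)
    have hg : kernelAction K
        (fun x => ∑ n ∈ Finset.range N, ((kernelAction K)^[n] f x - ∫ y, f y ∂π)) x =
        ∑ n ∈ Finset.range N, ((kernelAction K)^[n + 1] f x - ∫ y, f y ∂π) := by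
      have hi' (n : ℕ) : Integrable (fun y => (kernelAction K)^[n] f y - ∫ y, f y ∂π) (K x) :=
        (hi n).sub (integrable_const _)
      rw [kernelAction, integral_finsetSum _ fun n _ => hi' n]
      refine Finset.sum_congr rfl fun n _ => ?_
      rw [integral_sub (hi n) (integrable_const _), Function.iterate_succ_apply']
      simp [kernelAction]
    rw [hg, ← Finset.sum_sub_distrib, Finset.sum_range_sub'
      (fun n => (kernelAction K)^[n] f x - ∫ y, f y ∂π)]
    simpa using hbd N x

end Doeblin

/-- Hoeffding's lemma for a function bounded by `G`. -/
lemma integral_exp_mul_sub_integral_le {E : Type*} [MeasurableSpace E] {ν : Measure E}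
    [IsProbabilityMeasure ν] {g : E → ℝ} {G : ℝ} (hg : Measurable g) (hG : ∀ x, |g x| ≤ G)
    (t : ℝ) :
    Real.exp (-(t * ∫ x, g x ∂ν)) * ∫ x, Real.exp (t * g x) ∂ν ≤ Real.exp (t ^ 2 * G ^ 2 / 2) := by
  have h := (hasSubgaussianMGF_of_mem_Icc (μ := ν) hg.aemeasurable
    (ae_of_all _ fun x => abs_le.1 (hG x))).mgf_le t
  have habs : |G - -G| / 2 = |G| := by
    rw [sub_neg_eq_add, ← two_mul, abs_mul, abs_two]
    ring
  have hexp (x : E) : Real.exp (t * (g x - ∫ y, g y ∂ν)) =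
      Real.exp (-(t * ∫ y, g y ∂ν)) * Real.exp (t * g x) := by
    rw [← Real.exp_add]
    ring_nf
  simp only [mgf, hexp] at h
  rw [integral_const_mul] at h
  refine h.trans_eq ?_
  push_cast
  rw [Real.norm_eq_abs, habs, sq_abs]
  ring_nf

section MarkovChain

variable {Ω E : Type*} [MeasurableSpace E] {X : ℕ → Ω → E}

lemma measurable_natSigma {i j : ℕ} (h : j ≤ i) : Measurable[natSigma X i] (X j) := by
  have hle : MeasurableSpace.comap (X j) inferInstance ≤ natSigma X i :=
    le_iSup₂_of_le (f := fun (j : ℕ) (_ : j ≤ i) => MeasurableSpace.comap (X j) inferInstance)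
      j h le_rfl
  exact Measurable.mono (comap_measurable (X j)) hle le_rfl

/-- The martingale part of the additive functional `∑ i < n, (g - K g) (X i)`. -/
noncomputable def poissonMartingale (K : Kernel E E) (g : E → ℝ) (X : ℕ → Ω → E) (n : ℕ) (ω : Ω) :
    ℝ :=
  ∑ i ∈ Finset.range n, (g (X (i + 1) ω) - kernelAction K g (X i ω))

lemma poissonMartingale_succ (K : Kernel E E) (g : E → ℝ) (X : ℕ → Ω → E) (n : ℕ) (ω : Ω) :
    poissonMartingale K g X (n + 1) ω =
      poissonMartingale K g X n ω + (g (X (n + 1) ω) - kernelAction K g (X n ω)) :=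
  Finset.sum_range_succ _ _

lemma sum_sub_kernelAction_eq (K : Kernel E E) (g : E → ℝ) (X : ℕ → Ω → E) (n : ℕ) (ω : Ω) :
    ∑ i ∈ Finset.range n, (g (X i ω) - kernelAction K g (X i ω)) =
      poissonMartingale K g X n ω + (g (X 0 ω) - g (X n ω)) := by
  rw [← Finset.sum_range_sub' (fun i => g (X i ω)), poissonMartingale, ← Finset.sum_add_distrib]
  exact Finset.sum_congr rfl fun i _ => by ring

lemma abs_poissonMartingale_le (K : Kernel E E) [IsMarkovKernel K] {g : E → ℝ} {G : ℝ}
    (hG : ∀ x, |g x| ≤ G) (n : ℕ) (ω : Ω) : |poissonMartingale K g X n ω| ≤ n * (2 * G) := by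
  refine (Finset.abs_sum_le_sum_abs _ _).trans ?_
  refine (Finset.sum_le_card_nsmul _ _ (2 * G) fun i _ => ?_).trans (by simp)
  refine (abs_sub _ _).trans ?_
  linarith [hG (X (i + 1) ω), abs_kernelAction_le K hG (X i ω)]

lemma measurable_poissonMartingale_natSigma (K : Kernel E E) {g : E → ℝ} (hg : Measurable g) (n : ℕ) :
    Measurable[natSigma X n] (poissonMartingale K g X n) := by
  refine Finset.measurable_fun_sum _ fun i hmem => ?_
  have hi := Finset.mem_range.1 hmem
  exact (hg.comp (measurable_natSigma hi)).sub
    ((measurable_kernelAction K hg).comp (measurable_natSigma hi.le))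

lemma measurable_poissonMartingale [MeasurableSpace Ω] (hX : ∀ i, Measurable (X i)) (K : Kernel E E)
    {g : E → ℝ} (hg : Measurable g) (n : ℕ) : Measurable (poissonMartingale K g X n) :=
  Finset.measurable_fun_sum _ fun _ _ =>
    (hg.comp (hX _)).sub ((measurable_kernelAction K hg).comp (hX _))

lemma abs_exp_le_exp_of_abs_le {a b : ℝ} (h : |a| ≤ b) : |Real.exp a| ≤ Real.exp b := by
  rw [Real.abs_exp]
  exact Real.exp_le_exp.2 ((le_abs_self a).trans h)

lemma abs_mul_le_of_abs_le (t : ℝ) {a b : ℝ} (h : |a| ≤ b) : |t * a| ≤ |t| * b := by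
  rw [abs_mul]
  exact mul_le_mul_of_nonneg_left h (abs_nonneg t)

variable [MeasurableSpace Ω] {μ : Measure Ω} [IsProbabilityMeasure μ] {K : Kernel E E}
  [IsMarkovKernel K] {g : E → ℝ} {G : ℝ}

lemma integrable_exp_mul_poissonMartingale (hX : ∀ i, Measurable (X i)) (hg : Measurable g)
    (hG : ∀ x, |g x| ≤ G) (t : ℝ) (n : ℕ) :
    Integrable (fun ω => Real.exp (t * poissonMartingale K g X n ω)) μ :=
  integrable_of_measurable_of_abs_le
    (((measurable_poissonMartingale hX K hg n).const_mul t).exp)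
    (fun ω => abs_exp_le_exp_of_abs_le (abs_mul_le_of_abs_le t (abs_poissonMartingale_le K hG n ω)))

/-- Azuma–Hoeffding bound for the exponential moments of the martingale part. -/
lemma integral_exp_poissonMartingale_le (hX : ∀ i, Measurable (X i))
    (hmarkov : ∀ (i : ℕ) (φ : E → ℝ), Measurable φ → (∃ Cφ, ∀ y, |φ y| ≤ Cφ) →
      ∀ (H : Ω → ℝ), Measurable[natSigma X i] H → (∃ CH, ∀ ω, |H ω| ≤ CH) →
      ∫ ω, H ω * φ (X (i + 1) ω) ∂μ = ∫ ω, H ω * ∫ y, φ y ∂(K (X i ω)) ∂μ)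
    (hg : Measurable g) (hG : ∀ x, |g x| ≤ G) (t : ℝ) (n : ℕ) :
    ∫ ω, Real.exp (t * poissonMartingale K g X n ω) ∂μ ≤ Real.exp (n * (t ^ 2 * G ^ 2 / 2)) := by
  induction n with
  | zero => simp [poissonMartingale]
  | succ n ih =>
    have hexp (x : E) := integral_exp_mul_sub_integral_le (ν := K x) hg hG t
    have hφ : Measurable fun y => Real.exp (t * g y) := (hg.const_mul t).exp
    have hφb : ∀ y, |Real.exp (t * g y)| ≤ Real.exp (|t| * G) :=
      fun y => abs_exp_le_exp_of_abs_le (abs_mul_le_of_abs_le t (hG y))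
    let H : Ω → ℝ := fun ω =>
      Real.exp (t * (poissonMartingale K g X n ω - kernelAction K g (X n ω)))
    have hHm : Measurable[natSigma X n] H :=
      Real.measurable_exp.comp (((measurable_poissonMartingale_natSigma K hg n).sub
        ((measurable_kernelAction K hg).comp (measurable_natSigma le_rfl))).const_mul t)
    have hHm' : Measurable H :=
      (((measurable_poissonMartingale hX K hg n).sub
        ((measurable_kernelAction K hg).comp (hX n))).const_mul t).exp
    have hHb : ∀ ω, |H ω| ≤ Real.exp (|t| * (n * (2 * G) + G)) := fun ω =>
      abs_exp_le_exp_of_abs_le (abs_mul_le_of_abs_le t ((abs_sub _ _).trans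
        (add_le_add (abs_poissonMartingale_le K hG n ω) (abs_kernelAction_le K hG _))))
    have hstep := hmarkov n _ hφ ⟨_, hφb⟩ H hHm ⟨_, hHb⟩
    calc ∫ ω, Real.exp (t * poissonMartingale K g X (n + 1) ω) ∂μ
        = ∫ ω, H ω * Real.exp (t * g (X (n + 1) ω)) ∂μ := by
          refine integral_congr_ae (ae_of_all _ fun ω => ?_)
          simp only [H]
          rw [poissonMartingale_succ, ← Real.exp_add]
          ring_nf
      _ = ∫ ω, H ω * ∫ y, Real.exp (t * g y) ∂(K (X n ω)) ∂μ := hstep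
      _ ≤ ∫ ω, Real.exp (t * poissonMartingale K g X n ω) * Real.exp (t ^ 2 * G ^ 2 / 2) ∂μ := by
          refine integral_mono ?_ ((integrable_exp_mul_poissonMartingale hX hg hG t n).mul_const _) ?_
          · refine integrable_of_measurable_of_abs_le
              (C := Real.exp (|t| * (n * (2 * G) + G)) * Real.exp (|t| * G))
              (hHm'.mul ((measurable_kernelAction K hφ).comp (hX n))) fun ω => ?_
            rw [abs_mul]
            exact mul_le_mul (hHb ω) (abs_kernelAction_le K hφb _) (abs_nonneg _)
              (Real.exp_nonneg _)
          · intro ω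
            have hsplit : H ω = Real.exp (t * poissonMartingale K g X n ω) *
                Real.exp (-(t * ∫ y, g y ∂(K (X n ω)))) := by
              simp only [H, kernelAction]
              rw [← Real.exp_add]
              ring_nf
            simp only [hsplit, mul_assoc]
            exact mul_le_mul_of_nonneg_left (hexp _) (Real.exp_nonneg _)
      _ ≤ Real.exp (n * (t ^ 2 * G ^ 2 / 2)) * Real.exp (t ^ 2 * G ^ 2 / 2) := by
          rw [integral_mul_const]
          exact mul_le_mul_of_nonneg_right ih (Real.exp_nonneg _)
      _ = Real.exp ((n + 1 : ℕ) * (t ^ 2 * G ^ 2 / 2)) := by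
          rw [← Real.exp_add]
          push_cast
          ring_nf

end MarkovChain

lemma rpow_le_rpow_mul_exp {p : ℝ} (hp : 0 < p) {y : ℝ} (hy : 0 ≤ y) :
    y ^ p ≤ p ^ p * Real.exp y := by
  have h : y / p ≤ Real.exp (y / p) := by linarith [Real.add_one_le_exp (y / p)]
  calc y ^ p = p ^ p * (y / p) ^ p := by
        rw [← Real.mul_rpow hp.le (by positivity), mul_div_cancel₀ _ hp.ne']
    _ ≤ p ^ p * Real.exp (y / p) ^ p := by gcongr
    _ = p ^ p * Real.exp y := by rw [← Real.exp_mul, div_mul_cancel₀ _ hp.ne']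

lemma exp_abs_le_exp_add_exp_neg (y : ℝ) : Real.exp |y| ≤ Real.exp y + Real.exp (-y) := by
  rcases abs_choice y with h | h <;> rw [h]
  · linarith [Real.exp_pos (-y)]
  · linarith [Real.exp_pos y]

/-- A variable within `c * s` of one with two-sided exponential moments at scale `s` has
`L^p` norm of order `s`. -/
lemma integral_abs_rpow_rpow_inv_le {Ω : Type*} [MeasurableSpace Ω] {μ : Measure Ω}
    {p s c A : ℝ} (hp : 1 ≤ p) (hs : 0 < s) {Y M : Ω → ℝ}
    (hYM : ∀ ω, |Y ω| ≤ |M ω| + c * s)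
    (hi : Integrable (fun ω => Real.exp (s⁻¹ * M ω)) μ)
    (hi' : Integrable (fun ω => Real.exp (-s⁻¹ * M ω)) μ)
    (hA : ∫ ω, Real.exp (s⁻¹ * M ω) ∂μ ≤ A) (hA' : ∫ ω, Real.exp (-s⁻¹ * M ω) ∂μ ≤ A) :
    (∫ ω, |Y ω| ^ p ∂μ) ^ (1 / p) ≤ s * (p * (Real.exp c * (2 * A)) ^ (1 / p)) := by
  have hp0 : 0 < p := by linarith
  have hA0 : 0 ≤ A := (integral_nonneg fun ω => Real.exp_nonneg _).trans hA
  have hpt : ∀ ω, |Y ω| ^ p ≤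
      (s * p) ^ p * Real.exp c * (Real.exp (s⁻¹ * M ω) + Real.exp (-s⁻¹ * M ω)) := by
    intro ω
    have hle : |Y ω| / s ≤ |s⁻¹ * M ω| + c := by
      rw [div_le_iff₀ hs, add_mul, abs_mul, abs_of_pos (inv_pos.2 hs)]
      have : s⁻¹ * |M ω| * s = |M ω| := by field_simp
      rw [this]
      exact hYM ω
    calc |Y ω| ^ p = s ^ p * (|Y ω| / s) ^ p := by
          rw [← Real.mul_rpow hs.le (by positivity), mul_div_cancel₀ _ hs.ne']
      _ ≤ s ^ p * (p ^ p * Real.exp (|s⁻¹ * M ω| + c)) := by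
          gcongr
          exact (rpow_le_rpow_mul_exp hp0 (by positivity)).trans (by gcongr)
      _ = (s * p) ^ p * Real.exp c * Real.exp |s⁻¹ * M ω| := by
          rw [Real.mul_rpow hs.le hp0.le, Real.exp_add]
          ring
      _ ≤ _ := by
          rw [neg_mul]
          gcongr
          exact exp_abs_le_exp_add_exp_neg _
  have hint : ∫ ω, |Y ω| ^ p ∂μ ≤ (s * p) ^ p * (Real.exp c * (2 * A)) := by
    calc ∫ ω, |Y ω| ^ p ∂μ
        ≤ ∫ ω, (s * p) ^ p * Real.exp c *
            (Real.exp (s⁻¹ * M ω) + Real.exp (-s⁻¹ * M ω)) ∂μ :=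
          integral_mono_of_nonneg (ae_of_all _ fun ω => by positivity)
            ((hi.add hi').const_mul _) (ae_of_all _ hpt)
      _ ≤ (s * p) ^ p * Real.exp c * (2 * A) := by
          rw [integral_const_mul, integral_add hi hi']
          gcongr
          linarith
      _ = _ := by ring
  calc (∫ ω, |Y ω| ^ p ∂μ) ^ (1 / p)
      ≤ ((s * p) ^ p * (Real.exp c * (2 * A))) ^ (1 / p) :=
        Real.rpow_le_rpow (integral_nonneg fun ω => by positivity) hint (by positivity)
    _ = s * (p * (Real.exp c * (2 * A)) ^ (1 / p)) := by
        rw [Real.mul_rpow (by positivity) (by positivity), one_div,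
          Real.rpow_rpow_inv (by positivity) hp0.ne', mul_assoc]

/-- Under the Doeblin minorization condition with constant `ε`, for every `p ≥ 1` there is a
constant `B(p,ε)` depending only on `p` and `ε` such that for every Markov kernel `K` with
invariant probability measure `π` satisfying the minorization, every bounded measurable `f`,
every starting point and every `N ≥ 1`, the chain `(X_i)` with kernel `K` satisfies
`E_x[ |N⁻¹ ∑_{i=1}^N f(X_i) - π(f)|^p ]^{1/p} ≤ B(p,ε) ‖f‖ / √N`. -/
theorem doeblin_lp_ergodic_bound (ε : ℝ) (hε : ε ∈ Set.Ioo (0 : ℝ) 1) (p : ℝ) (hp : 1 ≤ p) :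
    ∃ B : ℝ,
      ∀ (E : Type*) [MeasurableSpace E] (K : Kernel E E) [IsMarkovKernel K]
        (π : Measure E) [IsProbabilityMeasure π], π.bind (fun x => K x) = π →
      ∀ (κ : Measure E) [IsProbabilityMeasure κ], (∀ x : E, ENNReal.ofReal ε • κ ≤ K x) →
      ∀ (f : E → ℝ), Measurable f → ∀ C : ℝ, (∀ x, |f x| ≤ C) →
      ∀ (x₀ : E) (Ω : Type*) [MeasurableSpace Ω] (μ : Measure Ω) [IsProbabilityMeasure μ]
        (X : ℕ → Ω → E),
        X 0 = (fun _ => x₀) →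
        (∀ i, Measurable (X i)) →
        -- Markov property: conditionally on `X 0, …, X i`, `X (i+1)` has law `K (X i, ·)`.
        (∀ (i : ℕ) (φ : E → ℝ), Measurable φ → (∃ Cφ, ∀ y, |φ y| ≤ Cφ) →
          ∀ (H : Ω → ℝ), Measurable[natSigma X i] H → (∃ CH, ∀ ω, |H ω| ≤ CH) →
          ∫ ω, H ω * φ (X (i + 1) ω) ∂μ = ∫ ω, H ω * ∫ y, φ y ∂(K (X i ω)) ∂μ) →
      ∀ N : ℕ, 1 ≤ N →
        (∫ ω, |(N : ℝ)⁻¹ * (∑ i ∈ Finset.range N, f (X i ω)) - ∫ y, f y ∂π| ^ p ∂μ) ^ (1 / p)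
          ≤ B * C / Real.sqrt N := by
  refine ⟨2 / ε * (p * (Real.exp 3 * (2 * Real.exp (1 / 2))) ^ (1 / p)), ?_⟩
  intro E _ K _ π _ hπ κ _ hK f hf C hC x₀ Ω _ μ _ X _ hX hmarkov N hN
  have hε0 : 0 < ε := hε.1
  have hp0 : 0 < p := by linarith
  have hN0 : (0 : ℝ) < N := by exact_mod_cast hN
  rcases ((abs_nonneg _).trans (hC x₀)).eq_or_lt with rfl | hC0
  · have hf0 : ∀ x, f x = 0 := fun x => abs_nonpos_iff.1 (hC x)
    simp [hf0, Real.zero_rpow hp0.ne', Real.zero_rpow (inv_pos.2 hp0).ne']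
  obtain ⟨g, hg, hG, hr⟩ := exists_approx_poisson hε hπ hK hf hC0.le hC N
  set G : ℝ := 2 * C / ε with hGdef
  have hG0 : 0 < G := by positivity
  clear_value G
  have hsqrt : 0 < √(N : ℝ) := Real.sqrt_pos.2 hN0
  have hsq : √(N : ℝ) ^ 2 = N := Real.sq_sqrt hN0.le
  have hdev (ω : Ω) : |∑ i ∈ Finset.range N, (f (X i ω) - ∫ y, f y ∂π)| ≤
      |poissonMartingale K g X N ω| + 3 * G := by
    have hrem : |∑ i ∈ Finset.range N, (f (X i ω) - ∫ y, f y ∂π -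
        (g (X i ω) - kernelAction K g (X i ω)))| ≤ G := by
      refine (Finset.abs_sum_le_sum_abs _ _).trans ?_
      refine (Finset.sum_le_card_nsmul _ _ _ fun i _ => hr (X i ω)).trans ?_
      rw [Finset.card_range, nsmul_eq_mul, hGdef, div_eq_mul_inv, mul_left_comm]
      exact mul_le_mul_of_nonneg_left (mul_one_sub_pow_le_inv hε N) (by positivity)
    rw [Finset.sum_sub_distrib, sum_sub_kernelAction_eq] at hrem
    have h0 := abs_le.1 (hG (X 0 ω))
    have h1 := abs_le.1 (hG (X N ω))
    have h2 := abs_le.1 hrem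
    have h3 := le_abs_self (poissonMartingale K g X N ω)
    have h4 := neg_abs_le (poissonMartingale K g X N ω)
    exact abs_le.2 ⟨by linarith, by linarith⟩
  have hexp (t : ℝ) (ht : t ^ 2 * (G ^ 2 * N) = 1) :
      ∫ ω, Real.exp (t * poissonMartingale K g X N ω) ∂μ ≤ Real.exp (1 / 2) := by
    refine (integral_exp_poissonMartingale_le hX hmarkov hg hG t N).trans_eq ?_
    congr 1
    linear_combination ht / 2
  have hscale : (G * √N)⁻¹ ^ 2 * (G ^ 2 * N) = 1 := by
    rw [inv_pow, mul_pow, hsq]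
    exact inv_mul_cancel₀ (by positivity)
  have hmain := integral_abs_rpow_rpow_inv_le (μ := μ) (c := 3) hp (mul_pos hG0 hsqrt)
    (Y := fun ω => ∑ i ∈ Finset.range N, (f (X i ω) - ∫ y, f y ∂π))
    (M := poissonMartingale K g X N)
    (fun ω => (hdev ω).trans (by
      have : (1 : ℝ) ≤ √N := Real.one_le_sqrt.2 (by exact_mod_cast hN)
      nlinarith))
    (integrable_exp_mul_poissonMartingale hX hg hG _ N)
    (integrable_exp_mul_poissonMartingale hX hg hG _ N)
    (hexp _ hscale) (hexp _ (by rw [neg_sq, hscale]))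
  have hpt (ω : Ω) : |(N : ℝ)⁻¹ * (∑ i ∈ Finset.range N, f (X i ω)) - ∫ y, f y ∂π| ^ p =
      (N : ℝ)⁻¹ ^ p * |∑ i ∈ Finset.range N, (f (X i ω) - ∫ y, f y ∂π)| ^ p := by
    rw [← Real.mul_rpow (by positivity) (abs_nonneg _), ← abs_of_pos (inv_pos.2 hN0), ← abs_mul,
      abs_of_pos (inv_pos.2 hN0), Finset.sum_sub_distrib, mul_sub]
    simp [hN0.ne']
  simp_rw [hpt]
  rw [integral_const_mul, Real.mul_rpow (by positivity) (integral_nonneg fun ω => by positivity),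
    ← Real.rpow_mul (by positivity), mul_one_div_cancel hp0.ne', Real.rpow_one]
  refine (mul_le_mul_of_nonneg_left hmain (by positivity)).trans_eq ?_
  rw [hGdef]
  generalize (Real.exp 3 * (2 * Real.exp (1 / 2))) ^ (1 / p) = A
  field_simp
  rw [hsq]
end

section
/- Let K be a Markov kernel on a measurable space (E, ℰ) with invariant probability measure π satisfying the Doeblin condition K(x,·) ≥ ε κ(·) for all x ∈ E, where ε ∈ (0,1) and κ is a probability measure. Then for every n ≥ 0 and every x ∈ E, sup_{f : E → [0,1] measurable} | K^n(f)(x) − π(f) | ≤ (1 − ε)^n, where K^n denotes the n-fold iterate of the kernel and K^n(f)(x) = ∫ f(y) K^n(x, dy). -/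
open MeasureTheory ProbabilityTheory
open scoped ENNReal NNReal

/-- Iterates of a Markov kernel: `kpow K 0 = id`, `kpow K (n+1) = K ∘ₖ kpow K n`. -/
noncomputable def kpow {E : Type*} [MeasurableSpace E] (K : Kernel E E) : ℕ → Kernel E E :=
  fun n => Nat.rec Kernel.id (fun _ ih => K.comp ih) n

/-- The integral of a bounded measurable function against `μ.bind K`. -/
theorem integral_bind_kernel {E : Type*} [MeasurableSpace E] (K : Kernel E E) [IsMarkovKernel K]
    (μ : Measure E) [IsProbabilityMeasure μ] {f : E → ℝ} (hf : Measurable f)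
    (hf01 : ∀ y, f y ∈ Set.Icc (0 : ℝ) 1) :
    ∫ y, f y ∂(μ.bind K) = ∫ z, ∫ y, f y ∂(K z) ∂μ := by
  have h := Kernel.integral_comp (κ := Kernel.const Unit μ) (η := K) (a := ()) (f := f)
    (Integrable.of_mem_Icc 0 1 hf.aemeasurable (ae_of_all _ hf01))
  simpa only [Kernel.comp_apply, Kernel.const_apply] using h

theorem integral_mem_Icc {E : Type*} [MeasurableSpace E] (μ : Measure E) [IsProbabilityMeasure μ]
    {f : E → ℝ} (hf : Measurable f) (hf01 : ∀ y, f y ∈ Set.Icc (0 : ℝ) 1) :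
    ∫ y, f y ∂μ ∈ Set.Icc (0 : ℝ) 1 := by
  refine ⟨integral_nonneg fun y => (hf01 y).1, ?_⟩
  have h := integral_mono (Integrable.of_mem_Icc 0 1 hf.aemeasurable (ae_of_all μ hf01))
    (integrable_const (1 : ℝ)) fun y => (hf01 y).2
  simpa using h

/-- A minorization `ε • κ ≤ μ` bounds integrals of nonnegative functions from below. -/
theorem mul_integral_le_of_smul_le {E : Type*} [MeasurableSpace E] {μ κ : Measure E}
    [IsProbabilityMeasure μ] {ε : ℝ} (hε : 0 ≤ ε) (h : ENNReal.ofReal ε • κ ≤ μ)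
    {f : E → ℝ} (hf : Measurable f) (hf01 : ∀ y, f y ∈ Set.Icc (0 : ℝ) 1) :
    ε * ∫ y, f y ∂κ ≤ ∫ y, f y ∂μ := by
  have h' := integral_mono_measure h (ae_of_all _ fun y => (hf01 y).1)
    (Integrable.of_mem_Icc 0 1 hf.aemeasurable (ae_of_all μ hf01))
  rwa [integral_smul_measure, ENNReal.toReal_ofReal hε, smul_eq_mul] at h'

instance isMarkovKernel_kpow {E : Type*} [MeasurableSpace E] (K : Kernel E E) [IsMarkovKernel K]
    (n : ℕ) : IsMarkovKernel (kpow K n) := by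
  induction n with
  | zero => exact inferInstanceAs (IsMarkovKernel Kernel.id)
  | succ n ih => exact inferInstanceAs (IsMarkovKernel (K.comp (kpow K n)))

/-- Under the Doeblin minorization condition, the iterates of a Markov kernel with invariant
probability measure `π` converge to `π` uniformly at geometric rate `(1-ε)^n`, in the sense of
test functions with values in `[0,1]`. -/
theorem doeblin_uniform_ergodicity
    {E : Type*} [MeasurableSpace E]
    (K : Kernel E E) [IsMarkovKernel K]
    (π : Measure E) [IsProbabilityMeasure π]
    (hinv : π.bind (fun x => K x) = π)
    (ε : ℝ) (hε : ε ∈ Set.Ioo (0 : ℝ) 1)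
    (κ : Measure E) [IsProbabilityMeasure κ]
    (hdoeblin : ∀ x : E, ENNReal.ofReal ε • κ ≤ K x) :
    ∀ (n : ℕ) (x : E) (f : E → ℝ), Measurable f → (∀ y, f y ∈ Set.Icc (0 : ℝ) 1) →
      |∫ y, f y ∂(kpow K n x) - ∫ y, f y ∂π| ≤ (1 - ε) ^ n := by
  obtain ⟨hε0, hε1⟩ := hε
  intro n x
  induction n with
  | zero =>
    intro f hf hf01
    have h1 := integral_mem_Icc (kpow K 0 x) hf hf01
    have h2 := integral_mem_Icc π hf hf01
    rw [pow_zero, abs_le]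
    constructor <;> linarith [h1.1, h1.2, h2.1, h2.2]
  | succ n ih =>
    intro f hf hf01
    set g : E → ℝ := fun z => ∫ y, f y ∂(K z) with hg
    have hgm : Measurable g := hf.stronglyMeasurable.integral_kernel.measurable
    have hg01 : ∀ z, g z ∈ Set.Icc (0 : ℝ) 1 := fun z => integral_mem_Icc (K z) hf hf01
    have hstep : ∫ y, f y ∂(kpow K (n + 1) x) = ∫ z, g z ∂(kpow K n x) := by
      rw [← integral_bind_kernel K (kpow K n x) hf hf01, ← Kernel.comp_apply]
      rfl
    have hπ : ∫ y, f y ∂π = ∫ z, g z ∂π := by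
      rw [← integral_bind_kernel K π hf hf01, hinv]
    set a : ℝ := ε * ∫ y, f y ∂κ with ha
    have hpos : 0 < 1 - ε := sub_pos.2 hε1
    have hlow (z : E) : a ≤ g z := mul_integral_le_of_smul_le hε0.le (hdoeblin z) hf hf01
    have hupp (z : E) : g z ≤ a + (1 - ε) := by
      have h := mul_integral_le_of_smul_le hε0.le (hdoeblin z) (f := fun y => 1 - f y)
        (measurable_const.sub hf) fun y => ⟨by linarith [(hf01 y).2], by linarith [(hf01 y).1]⟩
      have hsub (μ : Measure E) [IsProbabilityMeasure μ] :
          ∫ y, (1 - f y) ∂μ = 1 - ∫ y, f y ∂μ := by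
        rw [integral_sub (integrable_const _)
          (Integrable.of_mem_Icc 0 1 hf.aemeasurable (ae_of_all μ hf01))]
        simp
      rw [hsub, hsub, mul_sub, mul_one] at h
      linarith
    have hrescale (μ : Measure E) [IsProbabilityMeasure μ] :
        ∫ z, (g z - a) / (1 - ε) ∂μ = (∫ z, g z ∂μ - a) / (1 - ε) := by
      rw [integral_div, integral_sub
        (Integrable.of_mem_Icc 0 1 hgm.aemeasurable (ae_of_all μ hg01)) (integrable_const _)]
      simp
    have h := ih (fun z => (g z - a) / (1 - ε)) ((hgm.sub_const a).div_const _) fun z =>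
      ⟨div_nonneg (sub_nonneg.2 (hlow z)) hpos.le, (div_le_one hpos).2 (by linarith [hupp z])⟩
    rw [hrescale, hrescale, ← sub_div, sub_sub_sub_cancel_right, abs_div, abs_of_pos hpos,
      div_le_iff₀ hpos] at h
    rwa [hstep, hπ, pow_succ]
end

section
/- Let λ be a σ-finite measure on a measurable space (E, ℰ), let g : E → (0,∞) be measurable with 0 < ∫ g dλ < ∞, and let q be a probability density on E with respect to λ. Let K be the Metropolis–Hastings independence-sampler kernel with proposal density q and target π(dx) = (g(x)/∫g dλ) λ(dx), i.e. K(x, dy) = min{1, (g(y) q(x))/(g(x) q(y))} q(y) λ(dy) + r(x) δ_x(dy) where r(x) is the rejection probability. If there exists M < ∞ such that g(y)/q(y) ≤ M for all y ∈ E, then K satisfies the Doeblin minorization K(x, A) ≥ ε π(A) for all x ∈ E and A ∈ ℰ, with ε = (∫ g dλ)/M ∈ (0,1]. -/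
open MeasureTheory ProbabilityTheory
open scoped ENNReal NNReal

/-- The Metropolis–Hastings independence sampler with target density proportional to `g`
(w.r.t. a σ-finite measure `λ`) and proposal density `q` satisfies the Doeblin minorization
`K(x, A) ≥ ε π(A)` with `ε = (∫ g dλ)/M ∈ (0,1]`, provided `g/q ≤ M` (written here in the
division-free form `g ≤ M q`). -/
theorem independence_sampler_doeblin
    {E : Type*} [MeasurableSpace E]
    (lam : Measure E) [SigmaFinite lam]
    (g : E → ℝ) (hg : Measurable g) (hgpos : ∀ x, 0 < g x)
    (hgint : Integrable g lam) (hgI : 0 < ∫ x, g x ∂lam)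
    (q : E → ℝ) (hq : Measurable q) (hq0 : ∀ x, 0 ≤ q x) (hq1 : ∫ x, q x ∂lam = 1)
    (M : ℝ) (hM : ∀ y, g y ≤ M * q y)
    (K : Kernel E E) [IsMarkovKernel K] (r : E → ℝ≥0∞)
    (hK : ∀ (x : E) (A : Set E), MeasurableSet A →
      K x A =
        ENNReal.ofReal (∫ y in A, min 1 ((g y * q x) / (g x * q y)) * q y ∂lam) +
          r x * Measure.dirac x A)
    (π : Measure E)
    (hπ : ∀ A : Set E, MeasurableSet A →
      π A = ENNReal.ofReal ((∫ y in A, g y ∂lam) / ∫ y, g y ∂lam)) :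
    (0 < (∫ y, g y ∂lam) / M ∧ (∫ y, g y ∂lam) / M ≤ 1) ∧
    ∀ (x : E) (A : Set E), MeasurableSet A →
      ENNReal.ofReal ((∫ y, g y ∂lam) / M) * π A ≤ K x A := by
  have hqi : Integrable q lam := by
    by_contra h
    rw [integral_undef h] at hq1
    exact zero_ne_one hq1
  obtain ⟨x₀⟩ : Nonempty E := by
    by_contra h
    rw [not_nonempty_iff] at h
    rw [Measure.eq_zero_of_isEmpty lam, integral_zero_measure] at hgI
    exact lt_irrefl 0 hgI
  have hMq : ∀ y, 0 < M * q y := fun y => (hgpos y).trans_le (hM y)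
  have hMpos : 0 < M := pos_of_mul_pos_left (hMq x₀) (hq0 x₀)
  have hqpos : ∀ y, 0 < q y := fun y => pos_of_mul_pos_right (hMq y) hMpos.le
  refine ⟨⟨div_pos hgI hMpos, ?_⟩, fun x A hA => ?_⟩
  · rw [div_le_one hMpos]
    calc ∫ y, g y ∂lam ≤ ∫ y, M * q y ∂lam := integral_mono hgint (hqi.const_mul M) hM
      _ = M := by rw [integral_const_mul, hq1, mul_one]
  rw [hπ A hA, hK x A hA, ← ENNReal.ofReal_mul (div_pos hgI hMpos).le]
  refine le_add_right (ENNReal.ofReal_le_ofReal ?_)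
  have hscale : (∫ y, g y ∂lam) / M * ((∫ y in A, g y ∂lam) / ∫ y, g y ∂lam)
      = ∫ y in A, g y / M ∂lam := by
    rw [integral_div]
    field_simp
  rw [hscale]
  have hint : Integrable (fun y => min 1 ((g y * q x) / (g x * q y)) * q y) lam := by
    refine hqi.mono' (by fun_prop) (ae_of_all _ fun y => ?_)
    have hratio : 0 ≤ (g y * q x) / (g x * q y) :=
      div_nonneg (mul_nonneg (hgpos y).le (hq0 x)) (mul_nonneg (hgpos x).le (hq0 y))
    rw [Real.norm_of_nonneg (mul_nonneg (le_min zero_le_one hratio) (hq0 y))]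
    exact mul_le_of_le_one_left (hq0 y) (min_le_left _ _)
  refine integral_mono (hgint.div_const M).integrableOn hint.integrableOn fun y => ?_
  have hy := hqpos y
  have hgx := hgpos x
  dsimp only
  rw [min_mul_of_nonneg _ _ (hq0 y), one_mul]
  refine le_min ((div_le_iff₀' hMpos).2 (hM y)) ?_
  have hcancel : g y * q x / (g x * q y) * q y = g y * q x / g x := by field_simp
  rw [hcancel, div_le_div_iff₀ hMpos hgx]
  calc g y * g x ≤ g y * (M * q x) := mul_le_mul_of_nonneg_left (hM x) (hgpos y).le
    _ = g y * q x * M := by ring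
end

section
/- In the Feynman–Kac setup below, there exists a finite constant B, depending only on g̲, ḡ and τ (and not on n, p, the functions γ_q, or the kernels K_q), such that for all 0 ≤ p ≤ m ≤ n+1, sup_{x̃, x̃' ∈ F} Q_{p,m}(1)(x̃) / Q_{p,m}(1)(x̃') ≤ B. -/
open MeasureTheory ProbabilityTheory
open scoped ENNReal NNReal

/-- The Feynman–Kac semigroup `Q_{p,m} = Q_{p+1} Q_{p+2} ⋯ Q_m` (identity when `m ≤ p`). -/
noncomputable def QseqFK {F : Type*} [MeasurableSpace F]
    (Q : ℕ → Kernel F F) (p m : ℕ) : Kernel F F :=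
  Nat.rec Kernel.id (fun k ih => (Q (p + k + 1)).comp ih) (m - p)

/-- The first kernel of the Feynman–Kac semigroup can be split off on the left. -/
theorem QseqFK_succ_left {F : Type*} [MeasurableSpace F] (Q : ℕ → Kernel F F) (p k : ℕ) :
    QseqFK Q p (p + (k + 1)) = (QseqFK Q (p + 1) (p + 1 + k)).comp (Q (p + 1)) := by
  have key : ∀ k, (Nat.rec Kernel.id (fun k ih => (Q (p + k + 1)).comp ih) (k + 1) : Kernel F F)
      = (Nat.rec Kernel.id (fun k ih => (Q (p + 1 + k + 1)).comp ih) k : Kernel F F).comp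
          (Q (p + 1)) := by
    intro k
    induction k with
    | zero => simp
    | succ k ih =>
      have h : p + 1 + k + 1 = p + (k + 1) + 1 := by ring
      simp only [h] at ih ⊢
      rw [ih, Kernel.comp_assoc]
  unfold QseqFK
  rw [Nat.add_sub_cancel_left, Nat.add_sub_cancel_left]
  exact key k

theorem QseqFK_self_apply_univ {F : Type*} [MeasurableSpace F] (Q : ℕ → Kernel F F) (p : ℕ)
    (z : F) : QseqFK Q p p z Set.univ = 1 := by
  simp [QseqFK, Kernel.id_apply]

theorem QseqFK_apply_univ_of_lt {F : Type*} [MeasurableSpace F] (Q : ℕ → Kernel F F) {p m : ℕ}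
    (hpm : p < m) (z : F) {g : ℝ≥0∞} {μ : Measure F} (hQ : Q (p + 1) z = g • μ) :
    QseqFK Q p m z Set.univ = g * ∫⁻ w, QseqFK Q (p + 1) m w Set.univ ∂μ := by
  obtain ⟨k, rfl⟩ := Nat.exists_eq_add_of_lt hpm
  rw [add_assoc p k 1, QseqFK_succ_left, Kernel.comp_apply' _ _ _ MeasurableSet.univ, hQ,
    lintegral_smul_measure, smul_eq_mul, show p + 1 + k = p + (k + 1) by ring]

/-- Integrals against comparable measures, weighted by factors in `[a, b]`, are comparable. -/
theorem mul_lintegral_le_of_smul_le {E : Type*} [MeasurableSpace E] {μ ν : Measure E}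
    {a b t c c' d d' : ℝ≥0∞} (f : E → ℝ≥0∞) (hμν : t • μ ≤ ν)
    (hc : c ≤ b) (hd : d ≤ b) (hc' : a ≤ c') (hd' : a ≤ d') :
    a * a * t * (c * (d * ∫⁻ y, f y ∂μ)) ≤ b * b * (c' * (d' * ∫⁻ y, f y ∂ν)) := by
  have h : t * ∫⁻ y, f y ∂μ ≤ ∫⁻ y, f y ∂ν := by
    rw [← smul_eq_mul, ← lintegral_smul_measure]
    exact lintegral_mono' hμν le_rfl
  calc a * a * t * (c * (d * ∫⁻ y, f y ∂μ))
      = c * d * (a * a * (t * ∫⁻ y, f y ∂μ)) := by ring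
    _ ≤ b * b * (c' * d' * ∫⁻ y, f y ∂ν) := by gcongr
    _ = _ := by ring

/-- Uniform comparison of the masses, with weights bounded by `a ≤ 1 ≤ b` and mixing
constant `t ≤ 1`. -/
theorem QseqFK_apply_univ_comparable {E : Type*} [MeasurableSpace E] {n : ℕ} {a b t : ℝ≥0∞}
    (ha : a ≤ 1) (hb : 1 ≤ b) (ht : t ≤ 1)
    {g : ℕ → E → ℝ≥0∞} (hag : ∀ p ≤ n, ∀ x, a ≤ g p x) (hgb : ∀ p ≤ n, ∀ x, g p x ≤ b)
    {K : ℕ → Kernel E E} [∀ p, IsSFiniteKernel (K p)]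
    (hK : ∀ p, 1 ≤ p → p ≤ n → ∀ x x' : E, t • K p x' ≤ K p x)
    {Q : ℕ → Kernel (E × E) (E × E)}
    (hQ : ∀ p < n, ∀ z : E × E,
      Q (p + 1) z = g p z.1 • Measure.map (fun y => (z.2, y)) (K (p + 1) z.2))
    (hQlast : ∀ z : E × E, Q (n + 1) z = g n z.1 • Measure.dirac z)
    {p m : ℕ} (hpm : p ≤ m) (hm : m ≤ n + 1) (z z' : E × E) :
    a * a * t * QseqFK Q p m z Set.univ ≤ b * b * QseqFK Q p m z' Set.univ := by
  have hmeas : ∀ p, Measurable fun w => QseqFK Q p m w Set.univ := fun p =>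
    Kernel.measurable_coe _ MeasurableSet.univ
  have hlast : n < m → ∀ z, QseqFK Q n m z Set.univ = g n z.1 := by
    intro hnm z
    obtain rfl : m = n + 1 := by omega
    simp [QseqFK_apply_univ_of_lt Q hnm z (hQlast z), QseqFK_self_apply_univ]
  have hstep : ∀ q < n, q < m → ∀ z, QseqFK Q q m z Set.univ
      = g q z.1 * ∫⁻ y, QseqFK Q (q + 1) m (z.2, y) Set.univ ∂K (q + 1) z.2 := by
    intro q hq hqm z
    rw [QseqFK_apply_univ_of_lt Q hqm z (hQ q hq z),
      lintegral_map (hmeas _) measurable_prodMk_left]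
  have hfac : ∀ q ≤ m, ∃ c f : E → ℝ≥0∞, Measurable f ∧ (∀ x, a ≤ c x) ∧ (∀ x, c x ≤ b) ∧
      ∀ x y, QseqFK Q q m (x, y) Set.univ = c x * f y := by
    intro q hq
    rcases hq.eq_or_lt with rfl | hqm
    · exact ⟨1, 1, measurable_one, fun _ => ha, fun _ => hb,
        fun x y => by simp [QseqFK_self_apply_univ]⟩
    · rcases (show q ≤ n by omega).eq_or_lt with rfl | hqn
      · exact ⟨g q, 1, measurable_one, hag q le_rfl, hgb q le_rfl,
          fun x y => by simp [hlast hqm]⟩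
      · exact ⟨g q, fun y => ∫⁻ y', QseqFK Q (q + 1) m (y, y') Set.univ ∂K (q + 1) y,
          (hmeas (q + 1)).lintegral_kernel_prod_right',
          hag q hqn.le, hgb q hqn.le, fun x y => hstep q hqn hqm (x, y)⟩
  rcases hpm.eq_or_lt with rfl | hpm'
  · rw [QseqFK_self_apply_univ, QseqFK_self_apply_univ]
    refine mul_le_mul_left ?_ 1
    calc a * a * t ≤ 1 * 1 * 1 := by gcongr
      _ ≤ b * b := by simpa using mul_le_mul' hb hb
  rcases (show p ≤ n by omega).eq_or_lt with rfl | hpn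
  · rw [hlast hpm', hlast hpm']
    calc a * a * t * g p z.1 ≤ a * 1 * 1 * b := by gcongr; exact hgb p le_rfl _
      _ = b * 1 * a := by ring
      _ ≤ b * b * g p z'.1 := by gcongr; exact hag p le_rfl _
  · obtain ⟨c, f, hf, hac, hcb, hcf⟩ := hfac (p + 1) hpm'
    simp only [hstep p hpn hpm', hcf, lintegral_const_mul _ hf]
    exact mul_lintegral_le_of_smul_le f (hK _ (by omega) hpn _ _) (hgb p hpn.le _) (hcb _)
      (hag p hpn.le _) (hac _)

/-- In the data-point tempering Feynman–Kac setup, the total masses `Q_{p,m}(1)` are uniformly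
comparable: there is a constant `B` depending only on `g̲`, `ḡ` and `τ` such that
`Q_{p,m}(1)(x̃)/Q_{p,m}(1)(x̃') ≤ B` for all `0 ≤ p ≤ m ≤ n+1` and all `x̃, x̃'`. -/
theorem fk_mass_ratio_bound (gl gu τ : ℝ) (hglu : gl ≤ gu) (hτ : τ ∈ Set.Ioo (0 : ℝ) 1) :
    ∃ B : ℝ,
      ∀ (E : Type*) [MeasurableSpace E] (n : ℕ), 1 ≤ n →
      ∀ (γ : ℕ → E → ℝ), (∀ p, Measurable (γ p)) →
        (∀ p, 1 ≤ p → p ≤ n → ∀ x, γ p x ∈ Set.Icc gl gu) →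
      ∀ (K : ℕ → Kernel E E), (∀ p, IsMarkovKernel (K p)) →
        (∀ p, 1 ≤ p → p ≤ n → ∀ x x' : E, ENNReal.ofReal τ • K p x' ≤ K p x) →
      ∀ (G : ℕ → E × E → ℝ≥0∞), (∀ z : E × E, G 0 z = 1) →
        (∀ p, 1 ≤ p → p ≤ n → ∀ z : E × E, G p z = ENNReal.ofReal (Real.exp (γ p z.1))) →
      ∀ (M : ℕ → Kernel (E × E) (E × E)), (∀ p, IsMarkovKernel (M p)) →
        (∀ p, 1 ≤ p → p ≤ n → ∀ z : E × E,
          M p z = Measure.map (fun y => (z.2, y)) (K p z.2)) →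
        (∀ z : E × E, M (n + 1) z = Measure.dirac z) →
      ∀ (Q : ℕ → Kernel (E × E) (E × E)),
        (∀ p, 1 ≤ p → p ≤ n + 1 → ∀ z : E × E, Q p z = G (p - 1) z • M p z) →
      ∀ (p m : ℕ), p ≤ m → m ≤ n + 1 →
      ∀ (z z' : E × E),
        ((QseqFK Q p m z) Set.univ).toReal / ((QseqFK Q p m z') Set.univ).toReal ≤ B := by
  set a := min 1 (Real.exp gl)
  set b := max 1 (Real.exp gu)
  have ha : 0 < a := lt_min one_pos (Real.exp_pos _)
  have hb : 0 < b := lt_max_of_lt_left one_pos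
  refine ⟨b * b / (a * a * τ), ?_⟩
  intro E _ n _ γ _ hγ K hKm hK G hG0 hG M _ hM hMlast Q hQ p m hpm hm z z'
  let g : ℕ → E → ℝ≥0∞ := fun p x => if p = 0 then 1 else ENNReal.ofReal (Real.exp (γ p x))
  have hGg : ∀ p ≤ n, ∀ z : E × E, G p z = g p z.1 := by
    intro p hp z
    rcases Nat.eq_zero_or_pos p with rfl | h0
    · simp [g, hG0]
    · simp [g, h0.ne', hG p h0 hp]
  have hag : ∀ p ≤ n, ∀ x, ENNReal.ofReal a ≤ g p x := by
    intro p hp x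
    rcases Nat.eq_zero_or_pos p with rfl | h0
    · simp [g, a]
    · simp only [g, h0.ne', if_false]
      exact ENNReal.ofReal_le_ofReal
        ((min_le_right _ _).trans (Real.exp_le_exp.2 (hγ p h0 hp x).1))
  have hgb : ∀ p ≤ n, ∀ x, g p x ≤ ENNReal.ofReal b := by
    intro p hp x
    rcases Nat.eq_zero_or_pos p with rfl | h0
    · simp [g, b]
    · simp only [g, h0.ne', if_false]
      exact ENNReal.ofReal_le_ofReal
        ((Real.exp_le_exp.2 (hγ p h0 hp x).2).trans (le_max_right _ _))
  have (p : ℕ) : IsSFiniteKernel (K p) := have := hKm p; inferInstance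
  have key := QseqFK_apply_univ_comparable (by simp [a]) (by simp [b])
    (ENNReal.ofReal_le_one.2 hτ.2.le) hag hgb hK
    (fun p hp z => by
      rw [hQ (p + 1) (by omega) (by omega), hM (p + 1) (by omega) hp, Nat.add_sub_cancel,
        hGg p hp.le])
    (fun z => by
      rw [hQ (n + 1) (by omega) le_rfl, hMlast, Nat.add_sub_cancel, hGg n le_rfl])
    hpm hm z z'
  have hB : 0 ≤ b * b / (a * a * τ) := by have := hτ.1; positivity
  by_cases htop : QseqFK Q p m z' Set.univ = ∞
  · simpa [htop] using hB
  have hreal := ENNReal.toReal_mono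
    (ENNReal.mul_ne_top (ENNReal.mul_ne_top ENNReal.ofReal_ne_top ENNReal.ofReal_ne_top) htop) key
  simp only [ENNReal.toReal_mul, ENNReal.toReal_ofReal ha.le, ENNReal.toReal_ofReal hb.le,
    ENNReal.toReal_ofReal hτ.1.le] at hreal
  have hpos : 0 < a * a * τ := mul_pos (mul_pos ha ha) hτ.1
  refine div_le_of_le_mul₀ ENNReal.toReal_nonneg hB ?_
  rw [div_mul_eq_mul_div, le_div_iff₀ hpos]
  linarith
end

section
/- Let (E, ℰ) be a measurable space and let P be a Markov kernel from E to a measurable space (E', ℰ') whose Dobrushin contraction coefficient β(P) = sup_{x, x' ∈ E} ‖P(x,·) − P(x',·)‖_{tv} satisfies β(P) ≤ β. Then for every probability measure η on E, every nonnegative bounded measurable weight W : E → (0,∞), and every bounded measurable f : E' → ℝ, the weighted Jensen-type bound η( W² · ( P(f)(x) − η(W · P(f))/η(W) )² ) ≤ 4 ‖f‖² β² η(W²) holds, where P(f)(x) = ∫ f(y) P(x, dy), η(g) = ∫ g dη and ‖f‖ = sup |f|. -/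
open MeasureTheory ProbabilityTheory
open scoped ENNReal NNReal

/-- Total variation distance between two measures: `sup_A |μ(A) - ν(A)|` over measurable `A`. -/
noncomputable def tvDist {α : Type*} [MeasurableSpace α] (μ ν : Measure α) : ℝ :=
  ⨆ A : {A : Set α // MeasurableSet A}, |(μ A.1).toReal - (ν A.1).toReal|

/-- Every measurable set is a test set for the total variation distance. -/
theorem abs_measure_sub_le_tvDist {α : Type*} [MeasurableSpace α] (μ ν : Measure α)
    [IsFiniteMeasure μ] [IsFiniteMeasure ν] {A : Set α} (hA : MeasurableSet A) :
    |(μ A).toReal - (ν A).toReal| ≤ tvDist μ ν := by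
  refine le_ciSup (f := fun A : {A : Set α // MeasurableSet A} =>
    |(μ A.1).toReal - (ν A.1).toReal|) ⟨μ.real Set.univ + ν.real Set.univ, ?_⟩ ⟨A, hA⟩
  rintro _ ⟨B, rfl⟩
  have hμ : μ.real B.1 ≤ μ.real Set.univ := measureReal_mono (Set.subset_univ _)
  have hν : ν.real B.1 ≤ ν.real Set.univ := measureReal_mono (Set.subset_univ _)
  have hμ0 : 0 ≤ μ.real B.1 := measureReal_nonneg
  have hν0 : 0 ≤ ν.real B.1 := measureReal_nonneg
  change |μ.real B.1 - ν.real B.1| ≤ _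
  rw [abs_le]
  constructor <;> linarith

/-- The integrals of a measurable function with values in `[0, M]` differ by at most `M` times
the total variation distance. -/
theorem abs_integral_sub_integral_le_mul_tvDist {α : Type*} [MeasurableSpace α]
    (μ ν : Measure α) [IsFiniteMeasure μ] [IsFiniteMeasure ν] {g : α → ℝ} (hg : Measurable g)
    {M : ℝ} (hM : 0 ≤ M) (hg0 : ∀ y, 0 ≤ g y) (hgM : ∀ y, g y ≤ M) :
    |∫ y, g y ∂μ - ∫ y, g y ∂ν| ≤ M * tvDist μ ν := by
  have hint (ρ : Measure α) [IsFiniteMeasure ρ] : Integrable g ρ :=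
    .of_bound hg.aestronglyMeasurable M (ae_of_all _ fun y => by
      rw [Real.norm_eq_abs, abs_of_nonneg (hg0 y)]; exact hgM y)
  have hlevel (ρ : Measure α) [IsFiniteMeasure ρ] :
      Integrable (fun t => ρ.real {a | t ≤ g a}) (volume.restrict (Set.Ioc 0 M)) := by
    have hanti : Antitone fun t => ρ.real {a | t ≤ g a} :=
      fun s t hst => measureReal_mono fun a (ha : t ≤ g a) => hst.trans ha
    exact .of_bound hanti.measurable.aestronglyMeasurable (ρ.real Set.univ)
      (ae_of_all _ fun t => by
        rw [Real.norm_eq_abs, abs_of_nonneg measureReal_nonneg]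
        exact measureReal_mono (Set.subset_univ _))
  rw [(hint μ).integral_eq_integral_Ioc_meas_le (ae_of_all _ hg0) (ae_of_all _ hgM),
    (hint ν).integral_eq_integral_Ioc_meas_le (ae_of_all _ hg0) (ae_of_all _ hgM),
    ← integral_sub (hlevel μ) (hlevel ν), ← Real.norm_eq_abs]
  refine (norm_setIntegral_le_of_norm_le_const (C := tvDist μ ν) (by simp) fun t _ =>
    abs_measure_sub_le_tvDist μ ν (measurableSet_le measurable_const hg)).trans_eq ?_
  rw [Real.volume_real_Ioc_of_le hM, sub_zero, mul_comm]

/-- The integrals of a measurable function bounded by `C` against two probability measures differ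
by at most `2 C` times the total variation distance. -/
theorem abs_integral_sub_integral_le_two_mul_tvDist {α : Type*} [MeasurableSpace α]
    (μ ν : Measure α) [IsProbabilityMeasure μ] [IsProbabilityMeasure ν] {f : α → ℝ}
    (hf : Measurable f) {C : ℝ} (hC : 0 ≤ C) (hfC : ∀ y, |f y| ≤ C) :
    |∫ y, f y ∂μ - ∫ y, f y ∂ν| ≤ 2 * C * tvDist μ ν := by
  have hshift (ρ : Measure α) [IsProbabilityMeasure ρ] :
      ∫ y, (f y + C) ∂ρ = ∫ y, f y ∂ρ + C := by
    rw [integral_add (.of_bound hf.aestronglyMeasurable C (ae_of_all _ hfC))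
      (integrable_const C)]
    simp
  have h := abs_integral_sub_integral_le_mul_tvDist μ ν (hf.add_const C) (M := 2 * C)
    (by linarith) (fun y => by linarith [(abs_le.1 (hfC y)).1])
    (fun y => by linarith [(abs_le.1 (hfC y)).2])
  rwa [hshift, hshift, add_sub_add_right_eq_sub] at h

/-- If all oscillations of `h` are at most `K`, then `h` is within `K` of each of its weighted
averages. -/
theorem abs_sub_weighted_average_le {α : Type*} [MeasurableSpace α] {η : Measure α}
    {W h : α → ℝ} (hW : Integrable W η) (hWh : Integrable (fun x => W x * h x) η)
    (hW0 : ∀ x, 0 ≤ W x) (hpos : 0 < ∫ x, W x ∂η) {K : ℝ} (hK : ∀ x x', |h x - h x'| ≤ K)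
    (x : α) :
    |h x - (∫ x', W x' * h x' ∂η) / (∫ x', W x' ∂η)| ≤ K := by
  have hupper : ∫ x', W x' * h x' ∂η ≤ (h x + K) * ∫ x', W x' ∂η := by
    rw [← integral_const_mul]
    refine integral_mono hWh (hW.const_mul _) fun x' => ?_
    nlinarith [mul_nonneg (hW0 x') (sub_nonneg.2 (abs_le.1 (hK x x')).1)]
  have hlower : (h x - K) * ∫ x', W x' ∂η ≤ ∫ x', W x' * h x' ∂η := by
    rw [← integral_const_mul]
    refine integral_mono (hW.const_mul _) hWh fun x' => ?_
    nlinarith [mul_nonneg (hW0 x') (sub_nonneg.2 (abs_le.1 (hK x x')).2)]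
  rw [← div_le_iff₀ hpos] at hupper
  rw [← le_div_iff₀ hpos] at hlower
  rw [abs_le]
  constructor <;> linarith

/-- Weighted Jensen-type bound: if the Dobrushin contraction coefficient of a Markov kernel
`P` is at most `β`, then for any probability measure `η`, positive bounded measurable weight
`W` and bounded measurable `f`,
`η( W² (P(f) - η(W P(f))/η(W))² ) ≤ 4 ‖f‖² β² η(W²)`. -/
theorem weighted_jensen_dobrushin_bound
    {E : Type*} [MeasurableSpace E] {E' : Type*} [MeasurableSpace E']
    (P : Kernel E E') [IsMarkovKernel P]
    (β : ℝ) (hβ : ∀ x x' : E, tvDist (P x) (P x') ≤ β)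
    (η : Measure E) [IsProbabilityMeasure η]
    (W : E → ℝ) (hWmeas : Measurable W) (hWpos : ∀ x, 0 < W x)
    (D : ℝ) (hWbd : ∀ x, W x ≤ D)
    (f : E' → ℝ) (hf : Measurable f) (C : ℝ) (hfC : ∀ y, |f y| ≤ C) :
    ∫ x, (W x) ^ 2 *
        ((∫ y, f y ∂(P x)) -
          (∫ x', W x' * ∫ y, f y ∂(P x') ∂η) / (∫ x', W x' ∂η)) ^ 2 ∂η ≤
      4 * C ^ 2 * β ^ 2 * ∫ x, (W x) ^ 2 ∂η := by
  obtain ⟨x₀⟩ := nonempty_of_isProbabilityMeasure η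
  obtain ⟨y₀⟩ := nonempty_of_isProbabilityMeasure (P x₀)
  have hC : 0 ≤ C := (abs_nonneg _).trans (hfC y₀)
  set h : E → ℝ := fun x => ∫ y, f y ∂(P x)
  have hh : StronglyMeasurable h := hf.stronglyMeasurable.integral_kernel
  have hhC (x : E) : |h x| ≤ C := by
    simpa using norm_integral_le_of_norm_le_const (μ := P x) (f := f) (ae_of_all _ hfC)
  have hosc (x x' : E) : |h x - h x'| ≤ 2 * C * β :=
    (abs_integral_sub_integral_le_two_mul_tvDist (P x) (P x') hf hC hfC).trans
      (mul_le_mul_of_nonneg_left (hβ x x') (by linarith))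
  have hWnorm (x : E) : ‖W x‖ ≤ D := by
    rw [Real.norm_eq_abs, abs_of_pos (hWpos x)]; exact hWbd x
  have hWint : Integrable W η := .of_bound hWmeas.aestronglyMeasurable D (ae_of_all _ hWnorm)
  have hWh : Integrable (fun x => W x * h x) η :=
    hWint.mul_bdd hh.aestronglyMeasurable (ae_of_all _ hhC)
  have hWsq : Integrable (fun x => W x ^ 2) η := by
    simpa only [sq] using hWint.mul_bdd hWmeas.aestronglyMeasurable (ae_of_all _ hWnorm)
  have hpos : 0 < ∫ x, W x ∂η := by
    rw [integral_pos_iff_support_of_nonneg (fun x => (hWpos x).le) hWint,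
      Function.support_eq_univ fun x => (hWpos x).ne']
    simp
  rw [← integral_const_mul]
  refine integral_mono_of_nonneg (ae_of_all _ fun x => by positivity) (hWsq.const_mul _)
    (ae_of_all _ fun x => ?_)
  have hsq := sq_le_sq' (abs_le.1 (abs_sub_weighted_average_le hWint hWh
    (fun x => (hWpos x).le) hpos hosc x)).1 (abs_le.1 (abs_sub_weighted_average_le hWint hWh
    (fun x => (hWpos x).le) hpos hosc x)).2
  calc _ ≤ W x ^ 2 * (2 * C * β) ^ 2 := mul_le_mul_of_nonneg_left hsq (sq_nonneg _)
    _ = _ := by ring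
end
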